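/- The limit inferior, as n → ∞, of a(n)/n⁴ is at least 8/27. -/

import Mathlib

/-- The grid `A_n = {(x,y) ∈ ℤ² : 1 ≤ x, y ≤ n}`. -/
def gridSet (n : ℕ) : Set (ℤ × ℤ) :=
  {p | 1 ≤ p.1 ∧ p.1 ≤ (n : ℤ) ∧ 1 ≤ p.2 ∧ p.2 ≤ (n : ℤ)}

/-- The embedding of an integer lattice point into the real plane. -/
def toR2 (p : ℤ × ℤ) : ℝ × ℝ := ((p.1 : ℝ), (p.2 : ℝ))

/-- Squared Euclidean distance between two lattice points, as a natural number. -/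
def sqLen (p q : ℤ × ℤ) : ℕ := (q.1 - p.1).natAbs ^ 2 + (q.2 - p.2).natAbs ^ 2

/-- `f : ZMod (n²) → ℤ × ℤ` is a simple closed grid polygon on `A_n`:
it is a bijection onto `A_n`, and any two distinct (closed) edges of the closed
polygonal curve `f 0, f 1, …, f (n²-1), f 0` meet only in common endpoints. -/
structure IsSimpleClosedGridPolygon (n : ℕ) (f : ZMod (n ^ 2) → ℤ × ℤ) : Prop where
  inj : Function.Injective f
  range_eq : Set.range f = gridSet n
  simple : ∀ i j : ZMod (n ^ 2), i ≠ j →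
    segment ℝ (toR2 (f i)) (toR2 (f (i + 1))) ∩
        segment ℝ (toR2 (f j)) (toR2 (f (j + 1))) ⊆
      ({toR2 (f i), toR2 (f (i + 1))} : Set (ℝ × ℝ)) ∩
        ({toR2 (f j), toR2 (f (j + 1))} : Set (ℝ × ℝ))

/-- The weight `s(f)`: sum of the squared Euclidean side lengths. -/
def polyWeight (n : ℕ) (f : ZMod (n ^ 2) → ℤ × ℤ) : ℕ :=
  ∑ i ∈ Finset.range (n ^ 2), sqLen (f (i : ZMod (n ^ 2))) (f ((i : ZMod (n ^ 2)) + 1))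

/-- `a(n)`: the maximal weight of a simple closed grid polygon on `A_n`. -/
noncomputable def polyA (n : ℕ) : ℕ :=
  sSup {w : ℕ | ∃ f, IsSimpleClosedGridPolygon n f ∧ polyWeight n f = w}

/-- A grid polygon is proper if no three consecutive vertices are collinear. -/
def IsProper (n : ℕ) (f : ZMod (n ^ 2) → ℤ × ℤ) : Prop :=
  ∀ i : ZMod (n ^ 2),
    ¬ Collinear ℝ ({toR2 (f i), toR2 (f (i + 1)), toR2 (f (i + 2))} : Set (ℝ × ℝ))

/-- `a₀(n)`: the maximal weight of a proper simple closed grid polygon on `A_n`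
(the supremum in `ℕ`, equal to `0` if no proper polygon exists). -/
noncomputable def polyA0 (n : ℕ) : ℕ :=
  sSup {w : ℕ | ∃ f, IsSimpleClosedGridPolygon n f ∧ IsProper n f ∧ polyWeight n f = w}

/-- `t ∈ [0,1]` translating an integer to an integer is an endpoint of `[0,1]`. -/
lemma eq_zero_or_one_of_add_eq_int {t : ℝ} (h0 : 0 ≤ t) (h1 : t ≤ 1) {p m : ℤ}
    (h : (p : ℝ) + t = m) : t = 0 ∨ t = 1 := by
  have ht : t = ((m - p : ℤ) : ℝ) := by push_cast; linarith
  rw [ht] at h0 h1 ⊢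
  have h0' : 0 ≤ m - p := by exact_mod_cast h0
  have h1' : m - p ≤ 1 := by exact_mod_cast h1
  rcases (by omega : m - p = 0 ∨ m - p = 1) with h | h <;> simp [h]

lemma mem_segment_toR2 {p q : ℤ × ℤ} {z : ℝ × ℝ} (h : z ∈ segment ℝ (toR2 p) (toR2 q)) :
    ∃ t : ℝ, 0 ≤ t ∧ t ≤ 1 ∧ z.1 = p.1 + t * (q.1 - p.1) ∧ z.2 = p.2 + t * (q.2 - p.2) := by
  rw [segment_eq_image] at h
  obtain ⟨t, ⟨h0, h1⟩, rfl⟩ := h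
  refine ⟨t, h0, h1, ?_, ?_⟩ <;> simp [toR2] <;> ring

/-- Two distinct horizontal unit edges meet only in common endpoints. -/
lemma horizontal_inter_horizontal {p q p' q' : ℤ × ℤ} (hq : q = (p.1 + 1, p.2))
    (hq' : q' = (p'.1 + 1, p'.2)) (hne : p ≠ p') :
    segment ℝ (toR2 p) (toR2 q) ∩ segment ℝ (toR2 p') (toR2 q') ⊆
      ({toR2 p, toR2 q} : Set (ℝ × ℝ)) ∩ {toR2 p', toR2 q'} := by
  rintro z ⟨hz, hz'⟩
  obtain ⟨t, h0, h1, hx, hy⟩ := mem_segment_toR2 hz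
  obtain ⟨t', h0', h1', hx', hy'⟩ := mem_segment_toR2 hz'
  obtain ⟨x, y⟩ := p
  obtain ⟨x', y'⟩ := p'
  subst hq hq'
  simp only [Int.cast_add, Int.cast_one, sub_self, mul_zero, add_zero, add_sub_cancel_left,
    mul_one] at hx hy hx' hy'
  have hyy : y = y' := by exact_mod_cast hy.symm.trans hy'
  subst hyy
  have hxx : x ≠ x' := fun h => hne (by rw [h])
  simp only [toR2, Set.mem_inter_iff, Set.mem_insert_iff, Set.mem_singleton_iff, Prod.ext_iff,
    Int.cast_add, Int.cast_one]
  rcases lt_or_gt_of_ne hxx with h | h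
  · have : (x : ℝ) + 1 ≤ x' := by exact_mod_cast h
    exact ⟨Or.inr ⟨by linarith, hy⟩, Or.inl ⟨by linarith, hy⟩⟩
  · have : (x' : ℝ) + 1 ≤ x := by exact_mod_cast h
    exact ⟨Or.inl ⟨by linarith, hy⟩, Or.inr ⟨by linarith, hy⟩⟩

/-- A horizontal unit edge and an edge between adjacent rows meet only in common endpoints. -/
lemma horizontal_inter_strip {p q p' q' : ℤ × ℤ} (hq : q = (p.1 + 1, p.2))
    (hq' : q'.2 = p'.2 + 1) :
    segment ℝ (toR2 p) (toR2 q) ∩ segment ℝ (toR2 p') (toR2 q') ⊆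
      ({toR2 p, toR2 q} : Set (ℝ × ℝ)) ∩ {toR2 p', toR2 q'} := by
  rintro z ⟨hz, hz'⟩
  obtain ⟨t, h0, h1, hx, hy⟩ := mem_segment_toR2 hz
  obtain ⟨t', h0', h1', hx', hy'⟩ := mem_segment_toR2 hz'
  obtain ⟨x, y⟩ := p
  obtain ⟨x', y'⟩ := p'
  obtain ⟨u', v'⟩ := q'
  simp only at hq'
  subst hq hq'
  simp only [Int.cast_add, Int.cast_one, sub_self, mul_zero, add_zero, add_sub_cancel_left,
    mul_one] at hx hy hx' hy'
  simp only [toR2, Set.mem_inter_iff, Set.mem_insert_iff, Set.mem_singleton_iff, Prod.ext_iff,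
    Int.cast_add, Int.cast_one]
  rcases eq_zero_or_one_of_add_eq_int h0' h1' (hy'.symm.trans hy) with rfl | rfl
  · rw [zero_mul, add_zero] at hx'
    rw [add_zero] at hy'
    refine ⟨?_, Or.inl ⟨hx', hy'⟩⟩
    rcases eq_zero_or_one_of_add_eq_int h0 h1 (hx.symm.trans hx') with rfl | rfl
    · exact Or.inl ⟨by linarith, hy⟩
    · exact Or.inr ⟨by linarith, hy⟩
  · have hx'' : z.1 = u' := by linarith
    refine ⟨?_, Or.inr ⟨hx'', hy'⟩⟩
    rcases eq_zero_or_one_of_add_eq_int h0 h1 (hx.symm.trans hx'') with rfl | rfl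
    · exact Or.inl ⟨by linarith, hy⟩
    · exact Or.inr ⟨by linarith, hy⟩

/-- Two distinct edges between adjacent rows that do not cross when they lie in the same
strip meet only in common endpoints; the first edge is assumed not to lie above the second. -/
lemma strip_inter_strip_of_le {p q p' q' : ℤ × ℤ} (hq : q.2 = p.2 + 1) (hq' : q'.2 = p'.2 + 1)
    (hle : p.2 ≤ p'.2) (hne : (p, q) ≠ (p', q'))
    (hmono : p.2 = p'.2 → (p.1 ≤ p'.1 ∧ q.1 ≤ q'.1) ∨ (p'.1 ≤ p.1 ∧ q'.1 ≤ q.1)) :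
    segment ℝ (toR2 p) (toR2 q) ∩ segment ℝ (toR2 p') (toR2 q') ⊆
      ({toR2 p, toR2 q} : Set (ℝ × ℝ)) ∩ {toR2 p', toR2 q'} := by
  rintro z ⟨hz, hz'⟩
  obtain ⟨t, h0, h1, hx, hy⟩ := mem_segment_toR2 hz
  obtain ⟨t', h0', h1', hx', hy'⟩ := mem_segment_toR2 hz'
  obtain ⟨x, y⟩ := p
  obtain ⟨u, v⟩ := q
  obtain ⟨x', y'⟩ := p'
  obtain ⟨u', v'⟩ := q'
  simp only at hq hq' hle hmono
  subst hq hq'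
  simp only [Int.cast_add, Int.cast_one, add_sub_cancel_left, mul_one] at hx hy hx' hy'
  simp only [toR2, Set.mem_inter_iff, Set.mem_insert_iff, Set.mem_singleton_iff, Prod.ext_iff,
    Int.cast_add, Int.cast_one]
  rcases hle.eq_or_lt with h | h
  · subst h
    have htt : t' = t := by linarith
    subst htt
    have key : t' = 0 ∨ t' = 1 := by
      by_contra! hcon
      have hpos : 0 < t' := lt_of_le_of_ne h0 hcon.1.symm
      have hpos' : 0 < 1 - t' := by linarith [lt_of_le_of_ne h1 hcon.2]
      have e : (1 - t') * ((x : ℝ) - x') + t' * (u - u') = 0 := by linarith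
      apply hne
      rcases hmono rfl with ⟨ha, hb⟩ | ⟨ha, hb⟩
      · have ha' : (x : ℝ) ≤ x' := by exact_mod_cast ha
        have hb' : (u : ℝ) ≤ u' := by exact_mod_cast hb
        have e1 : (x : ℝ) = x' := by nlinarith
        have e2 : (u : ℝ) = u' := by nlinarith
        rw [Int.cast_injective e1, Int.cast_injective e2]
      · have ha' : (x' : ℝ) ≤ x := by exact_mod_cast ha
        have hb' : (u' : ℝ) ≤ u := by exact_mod_cast hb
        have e1 : (x : ℝ) = x' := by nlinarith
        have e2 : (u : ℝ) = u' := by nlinarith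
        rw [Int.cast_injective e1, Int.cast_injective e2]
    rcases key with rfl | rfl
    · exact ⟨Or.inl ⟨by linarith, by linarith⟩, Or.inl ⟨by linarith, by linarith⟩⟩
    · exact ⟨Or.inr ⟨by linarith, by linarith⟩, Or.inr ⟨by linarith, by linarith⟩⟩
  · have h' : (y : ℝ) + 1 ≤ y' := by exact_mod_cast h
    have ht : t = 1 := by linarith
    have ht' : t' = 0 := by linarith
    subst ht ht'
    exact ⟨Or.inr ⟨by linarith, by linarith⟩, Or.inl ⟨by linarith, by linarith⟩⟩

/-- The oriented edges used by the zigzag polygon on `A_{a+b+1}`: horizontal unit edges, zigzag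
edges of horizontal extent `b` or `b + 1` between adjacent rows, and vertical unit edges in the
last column and in the upper left corner. -/
def ZigzagEdge (a b : ℕ) (p q : ℤ × ℤ) : Prop :=
  q = (p.1 + 1, p.2) ∨
    (q.2 = p.2 + 1 ∧
      ((p.2 < a + b ∧ q.1 ≤ a + b ∧ p.1 ≤ a ∧ (q.1 = p.1 + b ∨ q.1 = p.1 + b + 1)) ∨
        (p.1 = a + b + 1 ∧ q.1 = a + b + 1) ∨ (p.2 = a + b ∧ p.1 = 1 ∧ q.1 = 1)))

lemma ZigzagEdge.inter_subset {a b : ℕ} {p q p' q' : ℤ × ℤ} (h : ZigzagEdge a b p q)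
    (h' : ZigzagEdge a b p' q') (hne : (p, q) ≠ (p', q')) :
    segment ℝ (toR2 p) (toR2 q) ∩ segment ℝ (toR2 p') (toR2 q') ⊆
      ({toR2 p, toR2 q} : Set (ℝ × ℝ)) ∩ {toR2 p', toR2 q'} := by
  rcases h with h | ⟨hq, h⟩ <;> rcases h' with h' | ⟨hq', h'⟩
  · refine horizontal_inter_horizontal h h' fun hp => hne ?_
    rw [h, h', hp]
  · exact horizontal_inter_strip h hq'
  · rw [Set.inter_comm, Set.inter_comm {toR2 p, toR2 q}]
    exact horizontal_inter_strip h' hq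
  · rcases le_total p.2 p'.2 with hle | hle
    · exact strip_inter_strip_of_le hq hq' hle hne (by omega)
    · rw [Set.inter_comm, Set.inter_comm {toR2 p, toR2 q}]
      exact strip_inter_strip_of_le hq' hq hle hne.symm (by omega)

/-- One period of the zigzag path: `a` zigzags between the rows `a + b - q` and `a + b - q - 1`,
followed by the middle points of the lower row. -/
def zigzagRow (a b q r : ℕ) : ℤ × ℤ :=
  if r < 2 * a then
    if r % 2 = 0 then ((b + 1 + r / 2 : ℕ), (a + b : ℤ) - q)
    else ((r / 2 + 1 : ℕ), (a + b : ℤ) - q - 1)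
  else ((r : ℤ) + 1 - a, (a + b : ℤ) - q - 1)

/-- The vertices of the zigzag polygon on `A_{a+b+1}`, in order. -/
def zigzag (a b k : ℕ) : ℤ × ℤ :=
  if k < b then ((k : ℤ) + 1, (a : ℤ) + b)
  else if k < b + (a + b - 1) * (a + b) then zigzagRow a b ((k - b) / (a + b)) ((k - b) % (a + b))
  else if k < (a + b) * (a + b) then ((k : ℤ) + 1 - ((a + b - 1) * (a + b) : ℕ), 1)
  else if k < (a + b) * (a + b) + (a + b + 1) then
    ((a : ℤ) + b + 1, (k : ℤ) + 1 - ((a + b) * (a + b) : ℕ))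
  else (((a + b) * (a + b) + 2 * (a + b) + 1 : ℕ) - (k : ℤ), (a : ℤ) + b + 1)

section zigzag

variable {a b : ℕ}

lemma mul_self_eq_add (ha : 1 ≤ a) :
    (a + b) * (a + b) = b + (a + b - 1) * (a + b) + a := by
  obtain ⟨c, rfl⟩ := Nat.exists_eq_add_of_le' ha
  rw [show c + 1 + b - 1 = c + b by omega]
  ring

lemma zigzag_top {k : ℕ} (h : k < b) : zigzag a b k = ((k : ℤ) + 1, (a : ℤ) + b) := by
  simp [zigzag, h]

lemma zigzag_row {q r : ℕ} (hq : q < a + b - 1) (hr : r < a + b) :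
    zigzag a b (b + q * (a + b) + r) = zigzagRow a b q r := by
  have h1 : b + q * (a + b) + r < b + (a + b - 1) * (a + b) := by nlinarith
  have h2 : b + q * (a + b) + r - b = r + (a + b) * q := by
    rw [mul_comm]; omega
  have h3 : (r + (a + b) * q) / (a + b) = q := by
    rw [Nat.add_mul_div_left _ _ (by omega), Nat.div_eq_of_lt hr, zero_add]
  have h4 : (r + (a + b) * q) % (a + b) = r := by
    rw [Nat.add_mul_mod_self_left, Nat.mod_eq_of_lt hr]
  rw [zigzag, if_neg (by omega), if_pos h1, h2, h3, h4]

lemma zigzag_bottom {s : ℕ} (hs : s < a) :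
    zigzag a b (b + (a + b - 1) * (a + b) + s) = ((b : ℤ) + 1 + s, 1) := by
  have := mul_self_eq_add (b := b) (by omega : 1 ≤ a)
  rw [zigzag, if_neg (by omega), if_neg (by omega), if_pos (by omega)]
  push_cast
  rw [Prod.mk.injEq]
  constructor <;> ring

lemma zigzag_right {s : ℕ} (ha : 1 ≤ a) (hs : s < a + b + 1) :
    zigzag a b ((a + b) * (a + b) + s) = ((a : ℤ) + b + 1, (s : ℤ) + 1) := by
  have := mul_self_eq_add (b := b) ha
  rw [zigzag, if_neg (by omega), if_neg (by omega), if_neg (by omega), if_pos (by omega)]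
  push_cast
  rw [Prod.mk.injEq]
  constructor <;> ring

lemma zigzag_return {s : ℕ} (ha : 1 ≤ a) :
    zigzag a b ((a + b) * (a + b) + (a + b + 1) + s) = ((a : ℤ) + b - s, (a : ℤ) + b + 1) := by
  have := mul_self_eq_add (b := b) ha
  rw [zigzag, if_neg (by omega), if_neg (by omega), if_neg (by omega), if_neg (by omega)]
  push_cast
  rw [Prod.mk.injEq]
  constructor <;> ring

lemma zigzag_cases (ha : 1 ≤ a) {k : ℕ} (hk : k < (a + b + 1) ^ 2) :
    k < b ∨ (∃ q r, q < a + b - 1 ∧ r < a + b ∧ k = b + q * (a + b) + r) ∨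
      (∃ s < a, k = b + (a + b - 1) * (a + b) + s) ∨
      (∃ s < a + b + 1, k = (a + b) * (a + b) + s) ∨
      ∃ s < a + b, k = (a + b) * (a + b) + (a + b + 1) + s := by
  have h := mul_self_eq_add (b := b) ha
  have hN : (a + b + 1) ^ 2 = (a + b) * (a + b) + (a + b + 1) + (a + b) := by ring
  rcases lt_or_ge k b with h1 | h1
  · exact Or.inl h1
  rcases lt_or_ge k (b + (a + b - 1) * (a + b)) with h2 | h2
  · refine Or.inr (Or.inl ⟨(k - b) / (a + b), (k - b) % (a + b), ?_, Nat.mod_lt _ (by omega), ?_⟩)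
    · exact (Nat.div_lt_iff_lt_mul (by omega)).2 (by omega)
    · have := Nat.div_add_mod' (k - b) (a + b)
      omega
  rcases lt_or_ge k ((a + b) * (a + b)) with h3 | h3
  · exact Or.inr (Or.inr (Or.inl ⟨k - (b + (a + b - 1) * (a + b)), by omega, by omega⟩))
  rcases lt_or_ge k ((a + b) * (a + b) + (a + b + 1)) with h4 | h4
  · exact Or.inr (Or.inr (Or.inr (Or.inl ⟨k - (a + b) * (a + b), by omega, by omega⟩)))
  · exact Or.inr (Or.inr (Or.inr (Or.inr
      ⟨k - ((a + b) * (a + b) + (a + b + 1)), by omega, by omega⟩)))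

lemma zigzag_mem (ha : 1 ≤ a) {k : ℕ} (hk : k < (a + b + 1) ^ 2) :
    zigzag a b k ∈ gridSet (a + b + 1) := by
  rcases zigzag_cases ha hk with h | ⟨q, r, hq, hr, rfl⟩ | ⟨s, hs, rfl⟩ | ⟨s, hs, rfl⟩ | ⟨s, hs, rfl⟩
  · rw [zigzag_top h]
    simp only [gridSet, Set.mem_ofPred_eq]
    omega
  · rw [zigzag_row hq hr, zigzagRow]
    split_ifs <;> simp only [gridSet, Set.mem_ofPred_eq] <;> omega
  · rw [zigzag_bottom hs]
    simp only [gridSet, Set.mem_ofPred_eq]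
    omega
  · rw [zigzag_right ha hs]
    simp only [gridSet, Set.mem_ofPred_eq]
    omega
  · rw [zigzag_return ha]
    simp only [gridSet, Set.mem_ofPred_eq]
    omega

lemma exists_zigzag_eq (ha : 1 ≤ a) (hab : a ≤ b) {p : ℤ × ℤ} (hp : p ∈ gridSet (a + b + 1)) :
    ∃ k < (a + b + 1) ^ 2, zigzag a b k = p := by
  have h := mul_self_eq_add (b := b) ha
  have hN : (a + b + 1) ^ 2 = (a + b) * (a + b) + (a + b + 1) + (a + b) := by ring
  have hrow : ∀ q r, q < a + b - 1 → r < a + b → zigzagRow a b q r = p →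
      ∃ k < (a + b + 1) ^ 2, zigzag a b k = p := by
    intro q r hq hr hp
    refine ⟨b + q * (a + b) + r, ?_, by rw [zigzag_row hq hr, hp]⟩
    have h1 : b + q * (a + b) + r < b + (a + b - 1) * (a + b) := by nlinarith
    omega
  obtain ⟨x, y⟩ := p
  simp only [gridSet, Set.mem_ofPred_eq] at hp
  obtain ⟨hx1, hx2, hy1, hy2⟩ := hp
  lift x to ℕ using by omega
  lift y to ℕ using by omega
  by_cases hxN : x = a + b + 1
  · refine ⟨(a + b) * (a + b) + (y - 1), by omega, ?_⟩
    rw [zigzag_right ha (by omega), Prod.mk.injEq]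
    omega
  by_cases hyN : y = a + b + 1
  · refine ⟨(a + b) * (a + b) + (a + b + 1) + (a + b - x), by omega, ?_⟩
    rw [zigzag_return ha, Prod.mk.injEq]
    omega
  by_cases hxb : x ≤ b
  · by_cases hyn : y = a + b
    · refine ⟨x - 1, by omega, ?_⟩
      rw [zigzag_top (by omega), Prod.mk.injEq]
      omega
    by_cases hxa : x ≤ a
    · refine hrow (a + b - 1 - y) (2 * x - 1) (by omega) (by omega) ?_
      rw [zigzagRow, if_pos (by omega), if_neg (by omega), Prod.mk.injEq]
      omega
    · refine hrow (a + b - 1 - y) (x + a - 1) (by omega) (by omega) ?_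
      rw [zigzagRow, if_neg (by omega), Prod.mk.injEq]
      omega
  · by_cases hy : y = 1
    · refine ⟨b + (a + b - 1) * (a + b) + (x - b - 1), by omega, ?_⟩
      rw [zigzag_bottom (by omega), Prod.mk.injEq]
      omega
    · refine hrow (a + b - y) (2 * (x - b - 1)) (by omega) (by omega) ?_
      rw [zigzagRow, if_pos (by omega), if_pos (by omega), Prod.mk.injEq]
      omega

lemma zigzagRow_edge {q r : ℕ} (hr : r + 1 < a + b) :
    ZigzagEdge a b (zigzagRow a b q r) (zigzagRow a b q (r + 1)) ∨
      ZigzagEdge a b (zigzagRow a b q (r + 1)) (zigzagRow a b q r) := by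
  unfold zigzagRow ZigzagEdge
  split_ifs <;> simp only [Prod.mk.injEq, and_true] <;> omega

lemma zigzag_edge (ha : 1 ≤ a) (hab : a ≤ b) {k : ℕ} (hk : k < (a + b + 1) ^ 2) :
    ZigzagEdge a b (zigzag a b k) (zigzag a b ((k + 1) % (a + b + 1) ^ 2)) ∨
      ZigzagEdge a b (zigzag a b ((k + 1) % (a + b + 1) ^ 2)) (zigzag a b k) := by
  have h := mul_self_eq_add (b := b) ha
  have hN : (a + b + 1) ^ 2 = (a + b) * (a + b) + (a + b + 1) + (a + b) := by ring
  rcases zigzag_cases ha hk with h1 | ⟨q, r, hq, hr, rfl⟩ | ⟨s, hs, rfl⟩ | ⟨s, hs, rfl⟩ | ⟨s, hs, rfl⟩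
  · rw [Nat.mod_eq_of_lt (by omega), zigzag_top h1]
    by_cases h2 : k + 1 < b
    · rw [zigzag_top h2]
      left; left; simp
    · have h3 : k + 1 = b + 0 * (a + b) + 0 := by omega
      rw [h3, zigzag_row (by omega) (by omega), zigzagRow, if_pos (by omega), if_pos (by omega)]
      left; left; simp only [Prod.mk.injEq]; omega
  · have h1 : b + q * (a + b) + r < b + (a + b - 1) * (a + b) := by nlinarith
    rw [Nat.mod_eq_of_lt (by omega), zigzag_row hq hr]
    by_cases h2 : r + 1 < a + b
    · rw [add_assoc, zigzag_row hq h2]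
      exact zigzagRow_edge h2
    have h3 : b + q * (a + b) + r + 1 = b + (q + 1) * (a + b) + 0 := by
      rw [add_mul, one_mul]; omega
    rw [h3]
    have h4 : zigzag a b (b + (q + 1) * (a + b) + 0) = ((b : ℤ) + 1, (a + b : ℤ) - q - 1) := by
      by_cases h4 : q + 1 < a + b - 1
      · rw [zigzag_row h4 (by omega), zigzagRow, if_pos (by omega), if_pos (by omega),
          Prod.mk.injEq]
        omega
      · rw [show q + 1 = a + b - 1 by omega, zigzag_bottom (by omega), Prod.mk.injEq]
        omega
    rw [h4, zigzagRow]
    left; left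
    split_ifs <;> simp only [Prod.mk.injEq, and_true] <;> omega
  · rw [Nat.mod_eq_of_lt (by omega), zigzag_bottom hs]
    by_cases h2 : s + 1 < a
    · rw [add_assoc _ s 1, zigzag_bottom h2]
      left; left; simp only [Prod.mk.injEq, and_true]; omega
    · have h3 : b + (a + b - 1) * (a + b) + s + 1 = (a + b) * (a + b) + 0 := by omega
      rw [h3, zigzag_right ha (by omega)]
      left; left; simp only [Prod.mk.injEq]; omega
  · rw [Nat.mod_eq_of_lt (by omega), zigzag_right ha hs]
    by_cases h2 : s + 1 < a + b + 1
    · rw [add_assoc _ s 1, zigzag_right ha h2]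
      left; right; simp
    · have h3 : (a + b) * (a + b) + s + 1 = (a + b) * (a + b) + (a + b + 1) + 0 := by omega
      rw [h3, zigzag_return ha]
      right; left; simp only [Prod.mk.injEq]; omega
  · rw [zigzag_return ha]
    by_cases h2 : s + 1 < a + b
    · rw [Nat.mod_eq_of_lt (by omega), add_assoc _ s 1, zigzag_return ha]
      right; left; simp only [Prod.mk.injEq, and_true]; omega
    · have h3 : (a + b) * (a + b) + (a + b + 1) + s + 1 = (a + b + 1) ^ 2 := by omega
      rw [h3, Nat.mod_self, zigzag_top (by omega)]
      right; right
      refine ⟨rfl, Or.inr (Or.inr ⟨rfl, rfl, ?_⟩)⟩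
      simp only
      omega

end zigzag

/-- The zigzag polygon is a simple closed grid polygon. -/
lemma isSimpleClosedGridPolygon_zigzag {a b : ℕ} (ha : 1 ≤ a) (hab : a ≤ b) :
    IsSimpleClosedGridPolygon (a + b + 1)
      (fun i : ZMod ((a + b + 1) ^ 2) => zigzag a b i.val) := by
  set M := (a + b + 1) ^ 2 with hM
  have hM9 : 9 ≤ M := by rw [hM]; nlinarith
  have : NeZero M := ⟨by omega⟩
  have : Fact (1 < M) := ⟨by omega⟩
  have hrange : Set.range (fun i : ZMod M => zigzag a b i.val) = gridSet (a + b + 1) := by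
    ext p
    constructor
    · rintro ⟨i, rfl⟩
      exact zigzag_mem ha (ZMod.val_lt i)
    · intro hp
      obtain ⟨k, hk, rfl⟩ := exists_zigzag_eq ha hab hp
      exact ⟨(k : ZMod M), by simp only [ZMod.val_cast_of_lt hk]⟩
  have hinj : Function.Injective (fun i : ZMod M => zigzag a b i.val) := by
    have hs : gridSet (a + b + 1) =
        ((Finset.Icc (1 : ℤ) (a + b + 1 : ℕ) ×ˢ Finset.Icc (1 : ℤ) (a + b + 1 : ℕ) :
          Finset (ℤ × ℤ)) : Set (ℤ × ℤ)) := by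
      ext p
      simp only [gridSet, Set.mem_ofPred_eq, Finset.coe_product, Set.mem_prod, Finset.coe_Icc,
        Set.mem_Icc]
      tauto
    rw [hs] at hrange
    have himg : Finset.univ.image (fun i : ZMod M => zigzag a b i.val) =
        Finset.Icc (1 : ℤ) (a + b + 1 : ℕ) ×ˢ Finset.Icc (1 : ℤ) (a + b + 1 : ℕ) := by
      apply Finset.coe_injective
      rw [← hrange]
      simp
    have hcard := congrArg Finset.card himg
    have hc : (Finset.univ.image (fun i : ZMod M => zigzag a b i.val)).card =
        (Finset.univ : Finset (ZMod M)).card := by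
      rw [hcard, Finset.card_univ, ZMod.card, Finset.card_product, Int.card_Icc, hM, sq]
      congr 1 <;> omega
    rw [Finset.card_image_iff, Finset.coe_univ] at hc
    exact Set.injOn_univ.1 hc
  have hsucc : ∀ i : ZMod M, (i + 1).val = (i.val + 1) % M := by
    intro i
    rw [ZMod.val_add, ZMod.val_one]
  refine ⟨hinj, hrange, fun i j hij => ?_⟩
  have hi := zigzag_edge ha hab (ZMod.val_lt i)
  have hj := zigzag_edge ha hab (ZMod.val_lt j)
  change ZigzagEdge a b (zigzag a b i.val) (zigzag a b ((i.val + 1) % M)) ∨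
    ZigzagEdge a b (zigzag a b ((i.val + 1) % M)) (zigzag a b i.val) at hi
  change ZigzagEdge a b (zigzag a b j.val) (zigzag a b ((j.val + 1) % M)) ∨
    ZigzagEdge a b (zigzag a b ((j.val + 1) % M)) (zigzag a b j.val) at hj
  rw [← hsucc] at hi hj
  have htwo : (i + 1 = j) → (j + 1 = i) → False := by
    rintro rfl h
    have h2 : ((2 : ℕ) : ZMod M) = 0 := by
      push_cast
      linear_combination h
    rw [ZMod.natCast_eq_zero_iff] at h2
    exact absurd (Nat.le_of_dvd (by norm_num) h2) (by omega)
  have hinj' : ∀ {u v : ZMod M}, zigzag a b u.val = zigzag a b v.val → u = v := fun h => hinj h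
  rcases hi with hi | hi <;> rcases hj with hj | hj
  · exact hi.inter_subset hj fun h => hij (hinj' (Prod.ext_iff.1 h).1)
  · rw [segment_symm ℝ (toR2 (zigzag a b j.val)),
      Set.pair_comm (toR2 (zigzag a b j.val))]
    exact hi.inter_subset hj fun h =>
      htwo (hinj' (Prod.ext_iff.1 h).2) (hinj' (Prod.ext_iff.1 h).1).symm
  · rw [segment_symm ℝ (toR2 (zigzag a b i.val)),
      Set.pair_comm (toR2 (zigzag a b i.val))]
    exact hi.inter_subset hj fun h =>
      htwo (hinj' (Prod.ext_iff.1 h).1) (hinj' (Prod.ext_iff.1 h).2).symm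
  · rw [segment_symm ℝ (toR2 (zigzag a b i.val)), Set.pair_comm (toR2 (zigzag a b i.val)),
      segment_symm ℝ (toR2 (zigzag a b j.val)), Set.pair_comm (toR2 (zigzag a b j.val))]
    exact hi.inter_subset hj fun h => hij (hinj' (Prod.ext_iff.1 h).2)

lemma sq_le_sqLen_zigzagRow {a b q r : ℕ} (hr : r + 1 < 2 * a) :
    b ^ 2 ≤ sqLen (zigzagRow a b q r) (zigzagRow a b q (r + 1)) := by
  have h : b ≤ ((zigzagRow a b q (r + 1)).1 - (zigzagRow a b q r).1).natAbs := by
    unfold zigzagRow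
    rw [if_pos hr, if_pos (by omega : r < 2 * a)]
    split_ifs <;> simp only <;> omega
  exact (Nat.pow_le_pow_left h 2).trans (Nat.le_add_right _ _)

lemma le_sum_sqLen_zigzag {a b : ℕ} (hab : a ≤ b) {q : ℕ} (hq : q ≤ a + b - 1) :
    q * ((2 * a - 1) * b ^ 2) ≤
      ∑ k ∈ Finset.range (b + q * (a + b)), sqLen (zigzag a b k) (zigzag a b (k + 1)) := by
  induction q with
  | zero => simp
  | succ q ih =>
    rw [add_mul, add_mul, ← add_assoc, Finset.sum_range_add]
    refine add_le_add (ih (by omega)) ?_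
    rw [one_mul, one_mul]
    calc (2 * a - 1) * b ^ 2 = ∑ _r ∈ Finset.range (2 * a - 1), b ^ 2 := by simp
      _ ≤ ∑ r ∈ Finset.range (2 * a - 1), sqLen (zigzag a b (b + q * (a + b) + r))
            (zigzag a b (b + q * (a + b) + r + 1)) := by
          refine Finset.sum_le_sum fun r hr => ?_
          rw [Finset.mem_range] at hr
          rw [add_assoc _ r 1, zigzag_row (by omega) (by omega), zigzag_row (by omega) (by omega)]
          exact sq_le_sqLen_zigzagRow (by omega)
      _ ≤ _ := Finset.sum_le_sum_of_subset (Finset.range_mono (by omega))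

lemma le_polyWeight_zigzag {a b : ℕ} (ha : 1 ≤ a) (hab : a ≤ b) :
    (a + b - 1) * ((2 * a - 1) * b ^ 2) ≤ polyWeight (a + b + 1)
      (fun i : ZMod ((a + b + 1) ^ 2) => zigzag a b i.val) := by
  have h := mul_self_eq_add (b := b) ha
  have hN : (a + b + 1) ^ 2 = (a + b) * (a + b) + (a + b + 1) + (a + b) := by ring
  refine (le_sum_sqLen_zigzag hab le_rfl).trans ?_
  calc _ = ∑ k ∈ Finset.range (b + (a + b - 1) * (a + b)),
        sqLen (zigzag a b (k : ZMod ((a + b + 1) ^ 2)).val)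
          (zigzag a b ((k : ZMod ((a + b + 1) ^ 2)) + 1).val) := by
        refine Finset.sum_congr rfl fun k hk => ?_
        rw [Finset.mem_range] at hk
        rw [← Nat.cast_succ, ZMod.val_cast_of_lt (by omega), ZMod.val_cast_of_lt (by omega)]
    _ ≤ _ := Finset.sum_le_sum_of_subset (Finset.range_mono (by omega))

lemma polyWeight_le {n : ℕ} {f : ZMod (n ^ 2) → ℤ × ℤ} (hf : IsSimpleClosedGridPolygon n f) :
    polyWeight n f ≤ 2 * n ^ 4 := by
  have hmem : ∀ i, f i ∈ gridSet n := fun i => hf.range_eq ▸ Set.mem_range_self i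
  have hle : ∀ i j, sqLen (f i) (f j) ≤ 2 * n ^ 2 := by
    intro i j
    have hi := hmem i
    have hj := hmem j
    simp only [gridSet, Set.mem_ofPred_eq] at hi hj
    have h1 : ((f j).1 - (f i).1).natAbs ≤ n := by omega
    have h2 : ((f j).2 - (f i).2).natAbs ≤ n := by omega
    have := Nat.pow_le_pow_left h1 2
    have := Nat.pow_le_pow_left h2 2
    unfold sqLen
    omega
  calc polyWeight n f ≤ ∑ _i ∈ Finset.range (n ^ 2), 2 * n ^ 2 :=
        Finset.sum_le_sum fun i _ => hle _ _
    _ = 2 * n ^ 4 := by rw [Finset.sum_const, Finset.card_range, smul_eq_mul]; ring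

lemma polyA_le (n : ℕ) : polyA n ≤ 2 * n ^ 4 :=
  csSup_le' (by rintro w ⟨f, hf, rfl⟩; exact polyWeight_le hf)

lemma polyWeight_le_polyA {n : ℕ} {f : ZMod (n ^ 2) → ℤ × ℤ}
    (hf : IsSimpleClosedGridPolygon n f) : polyWeight n f ≤ polyA n :=
  le_csSup ⟨2 * n ^ 4, by rintro w ⟨f, hf, rfl⟩; exact polyWeight_le hf⟩ ⟨f, hf, rfl⟩

lemma le_polyA {n : ℕ} (hn : 5 ≤ n) : (8 / 27 : ℝ) * ((n : ℝ) - 5) ^ 4 ≤ polyA n := by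
  obtain ⟨a, b, ha, hab, rfl, h1, h2⟩ :
      ∃ a b : ℕ, 1 ≤ a ∧ a ≤ b ∧ n = a + b + 1 ∧ n ≤ 3 * a + 3 ∧ 2 * n ≤ 3 * b + 2 :=
    ⟨(n - 1) / 3, n - 1 - (n - 1) / 3, by omega, by omega, by omega, by omega, by omega⟩
  have h := (le_polyWeight_zigzag ha hab).trans
    (polyWeight_le_polyA (isSimpleClosedGridPolygon_zigzag ha hab))
  have h' : (((a + b - 1) * ((2 * a - 1) * b ^ 2) : ℕ) : ℝ) ≤ polyA (a + b + 1) := by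
    exact_mod_cast h
  refine le_trans ?_ h'
  rw [Nat.cast_mul, Nat.cast_mul, Nat.cast_pow, Nat.cast_sub (by omega), Nat.cast_sub (by omega)]
  have h1' : ((a + b + 1 : ℕ) : ℝ) ≤ 3 * a + 3 := by exact_mod_cast h1
  have h2' : 2 * ((a + b + 1 : ℕ) : ℝ) ≤ 3 * b + 2 := by exact_mod_cast h2
  have hn' : (5 : ℝ) ≤ ((a + b + 1 : ℕ) : ℝ) := by exact_mod_cast hn
  push_cast at h1' h2' hn' ⊢
  set x : ℝ := (a : ℝ) + b + 1 - 5 with hx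
  have hx0 : 0 ≤ x := by linarith
  calc 8 / 27 * x ^ 4 = x * ((2 / 3 * x) * (2 / 3 * x) ^ 2) := by ring
    _ ≤ _ := by gcongr <;> linarith

/-- `liminf_{n → ∞} a(n)/n⁴ ≥ 8/27`. -/
theorem liminf_polyA_ge :
    (8 / 27 : ℝ) ≤ Filter.liminf (fun n : ℕ => (polyA n : ℝ) / (n : ℝ) ^ 4) Filter.atTop := by
  have hlim : Filter.Tendsto (fun n : ℕ => (8 / 27 : ℝ) * (1 - 5 / (n : ℝ)) ^ 4) Filter.atTop
      (nhds (8 / 27)) := by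
    have h := (((tendsto_const_div_atTop_nhds_zero_nat (5 : ℝ)).const_sub 1).pow 4).const_mul
      (8 / 27 : ℝ)
    simpa using h
  rw [← hlim.liminf_eq]
  refine Filter.liminf_le_liminf ?_ hlim.isBoundedUnder_ge ?_
  · filter_upwards [Filter.eventually_ge_atTop 5] with n hn
    have hn0 : (0 : ℝ) < n := by
      have : 0 < n := by omega
      exact_mod_cast this
    rw [le_div_iff₀ (by positivity), mul_assoc, ← mul_pow, sub_mul, one_mul,
      div_mul_cancel₀ _ hn0.ne']
    exact le_polyA hn
  · refine Filter.IsBoundedUnder.isCoboundedUnder_ge ⟨2, ?_⟩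
    rw [Filter.eventually_map]
    filter_upwards with n
    have h : (polyA n : ℝ) ≤ 2 * (n : ℝ) ^ 4 := by exact_mod_cast polyA_le n
    exact div_le_of_le_mul₀ (by positivity) (by norm_num) h
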